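/- arXiv:1904.04644 — 3 statements merged into one kernel-verified Lean document; each statement's English description precedes it below -/
import Mathlib

section
/- Let q > 1 be a real number and set d_q := q/(q − 1). Let N ≥ 1 and let y₀, y₁, …, y_N be nonnegative real numbers, and for 0 ≤ n ≤ N put y*_n := max_{0 ≤ k ≤ n} y_k. Then (y*_N)^q + d_q · y₀^q ≤ Σ_{n=0}^{N−1} (−q · d_q · (y*_n)^{q−1}) · (y_{n+1} − y_n) + (d_q · y_N)^q. -/
/-- Young's inequality for `a ^ (q - 1)` and `b`, cleared of denominators. -/
theorem mul_rpow_sub_one_mul_le {q a b : ℝ} (hq : 1 < q) (ha : 0 ≤ a) (hb : 0 ≤ b) :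
    q * (a ^ (q - 1) * b) ≤ (q - 1) * a ^ q + b ^ q := by
  have hq1 : q - 1 ≠ 0 := by linarith
  have hq0 : 0 < q := by linarith
  have h := Real.young_inequality_of_nonneg hb (Real.rpow_nonneg ha (q - 1))
    (Real.HolderConjugate.conjExponent hq)
  rw [Real.conjExponent, ← Real.rpow_mul ha, mul_div_cancel₀ q hq1] at h
  calc q * (a ^ (q - 1) * b) = q * (b * a ^ (q - 1)) := by ring
    _ ≤ q * (b ^ q / q + a ^ q / (q / (q - 1))) := by gcongr
    _ = (q - 1) * a ^ q + b ^ q := by field_simp; ring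

theorem rpow_sub_one_mul_self {q a : ℝ} (hq : 1 < q) (ha : 0 ≤ a) :
    a ^ (q - 1) * a = a ^ q := by
  rw [← Real.rpow_add_one' ha (by linarith), sub_add_cancel]

/-- One step of the summation by parts: the running maximum moves from `s` to `max s z`. -/
theorem max_rpow_sub_rpow_le {q s z : ℝ} (hq : 1 < q) (hs : 0 ≤ s) (hz : 0 ≤ z) :
    (max s z) ^ q - s ^ q ≤ q / (q - 1) * (z * ((max s z) ^ (q - 1) - s ^ (q - 1))) := by
  rcases le_total z s with h | h
  · simp [max_eq_left h]
  · have hq1 : 0 < q - 1 := by linarith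
    rw [max_eq_right h, div_mul_eq_mul_div, le_div_iff₀ hq1]
    linarith [mul_rpow_sub_one_mul_le hq hs hz,
      congrArg (q * ·) (rpow_sub_one_mul_self hq hz)]

theorem statement6 (q : ℝ) (hq : 1 < q) (N : ℕ) (hN : 1 ≤ N) (y : ℕ → ℝ)
    (hy : ∀ n ≤ N, 0 ≤ y n) :
    ((Finset.range (N + 1)).sup' Finset.nonempty_range_add_one y) ^ q
        + (q / (q - 1)) * y 0 ^ q ≤
      (∑ n ∈ Finset.range N,
        (-(q * (q / (q - 1)) *
            ((Finset.range (n + 1)).sup' Finset.nonempty_range_add_one y) ^ (q - 1)))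
          * (y (n + 1) - y n))
        + ((q / (q - 1)) * y N) ^ q := by
  have hq1 : 0 < q - 1 := by linarith
  set S : ℕ → ℝ := fun n => (Finset.range (n + 1)).sup' Finset.nonempty_range_add_one y with hS
  have hd : q * (q / (q - 1)) = q + q / (q - 1) := by field_simp; ring
  have hd0 : 0 ≤ q / (q - 1) := by positivity
  set d := q / (q - 1) with hd_def
  have hS0 : S 0 = y 0 := by simp [hS]
  have hSnonneg : ∀ n ≤ N, 0 ≤ S n := fun n hn =>
    (hy n hn).trans (Finset.le_sup' y (Finset.self_mem_range_succ n))
  have hSsucc : ∀ n, S (n + 1) = max (S n) (y (n + 1)) := by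
    intro n
    apply le_antisymm
    · refine Finset.sup'_le _ _ fun k hk => ?_
      rcases Nat.lt_succ_iff_lt_or_eq.mp (Finset.mem_range.mp hk) with h | h
      · exact le_max_of_le_left (Finset.le_sup' y (Finset.mem_range.mpr h))
      · exact le_max_of_le_right (h ▸ le_rfl)
    · exact max_le
        (Finset.sup'_mono y (Finset.range_subset_range.mpr (by omega)) _)
        (Finset.le_sup' y (Finset.self_mem_range_succ (n + 1)))
  have key : ∀ n ≤ N, q * S n ^ q + d * y 0 ^ q - q * d * (S n ^ (q - 1) * y n) ≤
      ∑ k ∈ Finset.range n, (-(q * d * S k ^ (q - 1))) * (y (k + 1) - y k) := by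
    intro n
    induction n with
    | zero =>
      intro hn
      rw [hS0, rpow_sub_one_mul_self hq (hy 0 hn), hd]
      simp only [Finset.range_zero, Finset.sum_empty]
      linarith
    | succ n ih =>
      intro hn
      have hstep := max_rpow_sub_rpow_le hq (hSnonneg n (by omega)) (hy (n + 1) hn)
      rw [← hSsucc, ← hd_def] at hstep
      have hstep' := mul_le_mul_of_nonneg_left hstep (by linarith : 0 ≤ q)
      rw [Finset.sum_range_succ]
      linarith [ih (by omega)]
  have hyoung := mul_rpow_sub_one_mul_le hq (hSnonneg N le_rfl)
    (mul_nonneg hd0 (hy N le_rfl))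
  have hkey := key N le_rfl
  change S N ^ q + d * y 0 ^ q ≤
    (∑ k ∈ Finset.range N, (-(q * d * S k ^ (q - 1))) * (y (k + 1) - y k)) + (d * y N) ^ q
  linarith
end

section
/- Let T > 0, let ω : [0, T] → [0, ∞) be right-continuous, and let 0 < a < b. Define τ₀ := 0 and recursively, for k ≥ 1, τ_{2k−1} := inf({t ∈ [τ_{2k−2}, T] : ω(t) < a} ∪ {T}) and τ_{2k} := inf({t ∈ [τ_{2k−1}, T] : ω(t) > b} ∪ {T}). Then for every t ∈ [0, T] and every m ∈ ℕ: Σ_{k=1}^{m} (ω(τ_{2k} ∧ t) − ω(τ_{2k−1} ∧ t)) ≥ −a + (b − a) · min(m, U_t^{a,b}(ω)). -/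
open Filter Topology

/-- There exist times `0 ≤ t₁ < t₂ < ⋯ < t_{2n} ≤ t` with `ω(t_{2k−1}) < a` and `ω(t_{2k}) > b`. -/
def IsUpcrossingSeq (ω : ℝ → ℝ) (a b t : ℝ) (n : ℕ) : Prop :=
  ∃ u : ℕ → ℝ, StrictMonoOn u (Set.Icc 1 (2 * n)) ∧
    (∀ k, 1 ≤ k → k ≤ 2 * n → u k ∈ Set.Icc 0 t) ∧
    (∀ k, 1 ≤ k → k ≤ n → ω (u (2 * k - 1)) < a ∧ b < ω (u (2 * k)))

/-- The number of up-crossings `U_t^{a,b}(ω) ∈ ℕ ∪ {∞}`. -/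
noncomputable def upcrossings (ω : ℝ → ℝ) (a b t : ℝ) : ℕ∞ :=
  sSup {n : ℕ∞ | ∃ m : ℕ, n = (m : ℕ∞) ∧ IsUpcrossingSeq ω a b t m}

/-- The recursively defined times `τ₀ = 0`,
`τ_{2k−1} = inf ({t ∈ [τ_{2k−2}, T] : ω(t) < a} ∪ {T})`,
`τ_{2k} = inf ({t ∈ [τ_{2k−1}, T] : ω(t) > b} ∪ {T})`. -/
noncomputable def upTimes (ω : ℝ → ℝ) (a b T : ℝ) : ℕ → ℝ
  | 0 => 0
  | n + 1 =>
      if Even n then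
        sInf ({t : ℝ | t ∈ Set.Icc (upTimes ω a b T n) T ∧ ω t < a} ∪ {T})
      else
        sInf ({t : ℝ | t ∈ Set.Icc (upTimes ω a b T n) T ∧ b < ω t} ∪ {T})

theorem IsUpcrossingSeq.mono {ω : ℝ → ℝ} {a b t : ℝ} {n k : ℕ} (h : IsUpcrossingSeq ω a b t n)
    (hk : k ≤ n) : IsUpcrossingSeq ω a b t k := by
  obtain ⟨u, h1, h2, h3⟩ := h
  exact ⟨u, h1.mono (Set.Icc_subset_Icc_right (by lia)), fun i hi hi' => h2 i hi (by lia),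
    fun i hi hi' => h3 i hi (by lia)⟩

theorem isUpcrossingSeq_of_le_upcrossings {ω : ℝ → ℝ} {a b t : ℝ} {n : ℕ}
    (h : (n : ℕ∞) ≤ upcrossings ω a b t) : IsUpcrossingSeq ω a b t n := by
  cases n with
  | zero => exact ⟨fun k => k, fun i hi => absurd hi (by simp), by lia, by lia⟩
  | succ n =>
    have hlt : (n : ℕ∞) < upcrossings ω a b t :=
      lt_of_lt_of_le (by exact_mod_cast n.lt_succ_self) h
    obtain ⟨_, ⟨k, rfl, hk⟩, hnk⟩ := lt_sSup_iff.1 hlt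
    exact hk.mono (by exact_mod_cast hnk)

section HittingTime

variable {s T : ℝ} {P : ℝ → Prop}

theorem bddBelow_hitting (hs : s ≤ T) : BddBelow ({t : ℝ | t ∈ Set.Icc s T ∧ P t} ∪ {T}) := by
  refine ⟨s, ?_⟩
  rintro x (hx | rfl)
  · exact hx.1.1
  · exact hs

theorem sInf_hitting_mem_Icc (hs : s ≤ T) :
    sInf ({t : ℝ | t ∈ Set.Icc s T ∧ P t} ∪ {T}) ∈ Set.Icc s T := by
  refine ⟨le_csInf ⟨T, Or.inr rfl⟩ ?_, csInf_le (bddBelow_hitting hs) (Or.inr rfl)⟩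
  rintro x (hx | rfl)
  · exact hx.1.1
  · exact hs

theorem sInf_hitting_le {x : ℝ} (hsx : s ≤ x) (hxT : x ≤ T) (hx : P x) :
    sInf ({t : ℝ | t ∈ Set.Icc s T ∧ P t} ∪ {T}) ≤ x :=
  csInf_le (bddBelow_hitting (hsx.trans hxT)) (Or.inl ⟨⟨hsx, hxT⟩, hx⟩)

theorem map_sInf_hitting_mem {ω : ℝ → ℝ} {C : Set ℝ} (hC : IsClosed C) (hP : ∀ x, P x → ω x ∈ C)
    (hs : s ≤ T) (hlt : sInf ({t : ℝ | t ∈ Set.Icc s T ∧ P t} ∪ {T}) < T)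
    (hω : ∀ x ∈ Set.Ico s T, ContinuousWithinAt ω (Set.Ici x) x) :
    ω (sInf ({t : ℝ | t ∈ Set.Icc s T ∧ P t} ∪ {T})) ∈ C := by
  have hmem := sInf_hitting_mem_Icc (P := P) hs
  have hbdd := bddBelow_hitting (P := P) hs
  have hcl := csInf_mem_closure ⟨T, Or.inr rfl⟩ hbdd
  have hle : ∀ x ∈ {t : ℝ | t ∈ Set.Icc s T ∧ P t},
      sInf ({t : ℝ | t ∈ Set.Icc s T ∧ P t} ∪ {T}) ≤ x := fun x hx => csInf_le hbdd (Or.inl hx)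
  generalize sInf ({t : ℝ | t ∈ Set.Icc s T ∧ P t} ∪ {T}) = r at *
  rw [closure_union, closure_singleton] at hcl
  have hr : r ∈ closure {t : ℝ | t ∈ Set.Icc s T ∧ P t} := hcl.resolve_right hlt.ne
  have := ((hω r ⟨hmem.1, hlt⟩).mono hle).mem_closure hr (fun x hx => hP x hx.2)
  rwa [hC.closure_eq] at this

end HittingTime

theorem upTimes_odd (ω : ℝ → ℝ) (a b T : ℝ) (k : ℕ) : upTimes ω a b T (2 * k + 1) =
    sInf ({t : ℝ | t ∈ Set.Icc (upTimes ω a b T (2 * k)) T ∧ ω t < a} ∪ {T}) := by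
  simp [upTimes]

theorem upTimes_even (ω : ℝ → ℝ) (a b T : ℝ) (k : ℕ) : upTimes ω a b T (2 * k + 2) =
    sInf ({t : ℝ | t ∈ Set.Icc (upTimes ω a b T (2 * k + 1)) T ∧ b < ω t} ∪ {T}) := by
  have h : ¬ Even (2 * k + 1) := by simp
  rw [upTimes, if_neg h]

section UpTimes

variable {ω : ℝ → ℝ} {a b T : ℝ}

theorem upTimes_mem_Icc (hT : 0 ≤ T) (n : ℕ) : upTimes ω a b T n ∈ Set.Icc 0 T := by
  induction n with
  | zero => simpa [upTimes] using hT
  | succ n ih =>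
    rw [upTimes]
    split_ifs
    · exact Set.Icc_subset_Icc_left ih.1 (sInf_hitting_mem_Icc ih.2)
    · exact Set.Icc_subset_Icc_left ih.1 (sInf_hitting_mem_Icc ih.2)

theorem monotone_upTimes (hT : 0 ≤ T) : Monotone (upTimes ω a b T) := by
  refine monotone_nat_of_le_succ fun n => ?_
  have h := (upTimes_mem_Icc (ω := ω) (a := a) (b := b) hT n).2
  rw [upTimes]
  split_ifs
  · exact (sInf_hitting_mem_Icc h).1
  · exact (sInf_hitting_mem_Icc h).1

theorem map_upTimes_odd_le (hT : 0 ≤ T)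
    (hω : ∀ t ∈ Set.Ico (0 : ℝ) T, ContinuousWithinAt ω (Set.Ici t) t) {k : ℕ}
    (hk : upTimes ω a b T (2 * k + 1) < T) : ω (upTimes ω a b T (2 * k + 1)) ≤ a := by
  have h := upTimes_mem_Icc (ω := ω) (a := a) (b := b) hT (2 * k)
  rw [upTimes_odd] at hk ⊢
  exact map_sInf_hitting_mem isClosed_Iic (fun x hx => hx.le) h.2 hk
    fun x hx => hω x ⟨h.1.trans hx.1, hx.2⟩

theorem le_map_upTimes_even (hT : 0 ≤ T)
    (hω : ∀ t ∈ Set.Ico (0 : ℝ) T, ContinuousWithinAt ω (Set.Ici t) t) {k : ℕ}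
    (hk : upTimes ω a b T (2 * k + 2) < T) : b ≤ ω (upTimes ω a b T (2 * k + 2)) := by
  have h := upTimes_mem_Icc (ω := ω) (a := a) (b := b) hT (2 * k + 1)
  rw [upTimes_even] at hk ⊢
  exact map_sInf_hitting_mem isClosed_Ici (fun x hx => hx.le) h.2 hk
    fun x hx => hω x ⟨h.1.trans hx.1, hx.2⟩

/-- The greedy times `upTimes` come no later than those of any other up-crossing sequence. -/
theorem upTimes_le_of_upcrossing {t : ℝ} (htT : t ≤ T) {u : ℕ → ℝ} {n : ℕ}
    (hmono : StrictMonoOn u (Set.Icc 1 (2 * n)))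
    (hmem : ∀ k, 1 ≤ k → k ≤ 2 * n → u k ∈ Set.Icc 0 t)
    (hu : ∀ k, 1 ≤ k → k ≤ n → ω (u (2 * k - 1)) < a ∧ b < ω (u (2 * k))) {k : ℕ} (hk : k < n) :
    upTimes ω a b T (2 * k + 1) ≤ u (2 * k + 1) ∧ upTimes ω a b T (2 * k + 2) ≤ u (2 * k + 2) := by
  have step : ∀ k < n, upTimes ω a b T (2 * k) ≤ u (2 * k + 1) →
      upTimes ω a b T (2 * k + 1) ≤ u (2 * k + 1) ∧
        upTimes ω a b T (2 * k + 2) ≤ u (2 * k + 2) := by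
    intro k hk h
    obtain ⟨hlo, hhi⟩ := hu (k + 1) (by lia) (by lia)
    have h1 : upTimes ω a b T (2 * k + 1) ≤ u (2 * k + 1) := by
      rw [upTimes_odd]
      exact sInf_hitting_le h ((hmem _ (by lia) (by lia)).2.trans htT) hlo
    refine ⟨h1, ?_⟩
    rw [upTimes_even]
    exact sInf_hitting_le
      (h1.trans (hmono ⟨by lia, by lia⟩ ⟨by lia, by lia⟩ (Nat.lt_succ_self _)).le)
      ((hmem _ (by lia) (by lia)).2.trans htT) hhi
  induction k with
  | zero => exact step 0 hk (by simpa [upTimes] using (hmem 1 le_rfl (by lia)).1)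
  | succ k ih =>
    exact step (k + 1) hk ((ih (by lia)).2.trans
      (hmono ⟨by lia, by lia⟩ ⟨by lia, by lia⟩ (Nat.lt_succ_self _)).le)

/-- A completed up-crossing contributes at least `b - a`. -/
theorem sub_le_gain_of_isUpcrossingSeq (hT : 0 ≤ T)
    (hω : ∀ t ∈ Set.Ico (0 : ℝ) T, ContinuousWithinAt ω (Set.Ici t) t) {t : ℝ} (htT : t ≤ T)
    {n : ℕ} (h : IsUpcrossingSeq ω a b t n) {k : ℕ} (hk : k < n) :
    b - a ≤ ω (min (upTimes ω a b T (2 * k + 2)) t) - ω (min (upTimes ω a b T (2 * k + 1)) t) := by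
  obtain ⟨u, hmono, hmem, hu⟩ := h
  obtain ⟨hodd, heven⟩ := upTimes_le_of_upcrossing htT hmono hmem hu hk
  have hlt : u (2 * k + 1) < u (2 * k + 2) :=
    hmono ⟨by lia, by lia⟩ ⟨by lia, by lia⟩ (Nat.lt_succ_self _)
  have hut : u (2 * k + 2) ≤ t := (hmem _ (by lia) (by lia)).2
  rw [min_eq_left (heven.trans hut), min_eq_left (hodd.trans (hlt.le.trans hut))]
  have h1 : ω (upTimes ω a b T (2 * k + 1)) ≤ a := map_upTimes_odd_le hT hω (by linarith)
  have h2 : b ≤ ω (upTimes ω a b T (2 * k + 2)) := by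
    rcases (upTimes_mem_Icc (ω := ω) (a := a) (b := b) hT (2 * k + 2)).2.lt_or_eq with h | h
    · exact le_map_upTimes_even hT hω h
    · have hb := (hu (k + 1) (by lia) (by lia)).2.le
      rwa [show u (2 * (k + 1)) = upTimes ω a b T (2 * k + 2) from
        le_antisymm ((hut.trans htT).trans_eq h.symm) heven] at hb
  linarith

/-- A single trade loses at most `a`. -/
theorem neg_le_gain (hT : 0 ≤ T)
    (hω : ∀ t ∈ Set.Ico (0 : ℝ) T, ContinuousWithinAt ω (Set.Ici t) t)
    (hnonneg : ∀ t ∈ Set.Icc (0 : ℝ) T, 0 ≤ ω t) (ha : 0 ≤ a) {t : ℝ} (ht : t ∈ Set.Icc 0 T)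
    (k : ℕ) :
    -a ≤ ω (min (upTimes ω a b T (2 * k + 2)) t) - ω (min (upTimes ω a b T (2 * k + 1)) t) := by
  have hle := monotone_upTimes (ω := ω) (a := a) (b := b) hT (Nat.le_succ (2 * k + 1))
  rcases le_or_gt t (upTimes ω a b T (2 * k + 1)) with h | h
  · rw [min_eq_right h, min_eq_right (h.trans hle)]
    linarith
  · have h1 : ω (upTimes ω a b T (2 * k + 1)) ≤ a := map_upTimes_odd_le hT hω (h.trans_le ht.2)
    have h2 : 0 ≤ ω (min (upTimes ω a b T (2 * k + 2)) t) :=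
      hnonneg _ ⟨le_min (upTimes_mem_Icc hT _).1 ht.1, (min_le_right _ _).trans ht.2⟩
    rw [min_eq_left h.le]
    linarith

/-- Over the first `m` trades, the loss is at most `a`, and there is none as long as the last trade was
closed before time `t`. -/
theorem mul_min_sub_le_sum_gain (hT : 0 ≤ T)
    (hω : ∀ t ∈ Set.Ico (0 : ℝ) T, ContinuousWithinAt ω (Set.Ici t) t)
    (hnonneg : ∀ t ∈ Set.Icc (0 : ℝ) T, 0 ≤ ω t) (ha : 0 ≤ a) (hab : a ≤ b) {t : ℝ}
    (ht : t ∈ Set.Icc 0 T) {n : ℕ} (h : IsUpcrossingSeq ω a b t n) (m : ℕ) :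
    (b - a) * (min m n : ℕ) - (if m ≤ n ∨ upTimes ω a b T (2 * m) < t then 0 else a) ≤
      ∑ k ∈ Finset.range m, (ω (min (upTimes ω a b T (2 * k + 2)) t)
        - ω (min (upTimes ω a b T (2 * k + 1)) t)) := by
  induction m with
  | zero => simp
  | succ m ih =>
    rw [Finset.sum_range_succ, show 2 * (m + 1) = 2 * m + 2 from rfl]
    have hmono := monotone_upTimes (ω := ω) (a := a) (b := b) hT
    have h01 := hmono (Nat.le_succ (2 * m))
    have h12 := hmono (Nat.le_succ (2 * m + 1))
    rcases lt_or_ge m n with hmn | hmn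
    · have hgain := sub_le_gain_of_isUpcrossingSeq hT hω ht.2 h hmn
      rw [if_pos (Or.inl hmn.le), min_eq_left hmn.le] at ih
      rw [if_pos (Or.inl (Nat.succ_le_of_lt hmn)), min_eq_left (Nat.succ_le_of_lt hmn)]
      push_cast
      linarith
    · rw [min_eq_right hmn] at ih
      rw [min_eq_right (hmn.trans m.le_succ)]
      rcases lt_or_ge (upTimes ω a b T (2 * m + 2)) t with h2 | h2
      · have hlo : ω (upTimes ω a b T (2 * m + 1)) ≤ a :=
          map_upTimes_odd_le hT hω ((h12.trans_lt h2).trans_le ht.2)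
        have hhi : b ≤ ω (upTimes ω a b T (2 * m + 2)) :=
          le_map_upTimes_even hT hω (h2.trans_le ht.2)
        rw [if_pos (Or.inr ((h01.trans h12).trans_lt h2))] at ih
        rw [if_pos (Or.inr h2), min_eq_left h2.le, min_eq_left (h12.trans h2.le)]
        linarith
      · rw [if_neg (not_or.2 ⟨by lia, h2.not_gt⟩)]
        rcases lt_or_ge (upTimes ω a b T (2 * m)) t with h0 | h0
        · have := neg_le_gain (b := b) hT hω hnonneg ha ht m
          rw [if_pos (Or.inr h0)] at ih
          linarith
        · have hif : (if m ≤ n ∨ upTimes ω a b T (2 * m) < t then 0 else a) ≤ a := by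
            split_ifs <;> linarith
          rw [min_eq_right h2, min_eq_right (h0.trans h01)]
          linarith

end UpTimes

theorem statement9 (T : ℝ) (hT : 0 < T) (ω : ℝ → ℝ)
    (hright : ∀ t ∈ Set.Ico (0 : ℝ) T, ContinuousWithinAt ω (Set.Ici t) t)
    (hnonneg : ∀ t ∈ Set.Icc (0 : ℝ) T, 0 ≤ ω t)
    (a b : ℝ) (ha : 0 < a) (hab : a < b)
    (t : ℝ) (ht : t ∈ Set.Icc (0 : ℝ) T) (m : ℕ) :
    -a + (b - a) * ((min (m : ℕ∞) (upcrossings ω a b t)).toNat : ℝ) ≤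
      ∑ k ∈ Finset.range m,
        (ω (min (upTimes ω a b T (2 * (k + 1))) t)
          - ω (min (upTimes ω a b T (2 * (k + 1) - 1)) t)) := by
  obtain ⟨n, hn⟩ := ENat.ne_top_iff_exists.1
    (ne_top_of_le_ne_top (ENat.natCast_ne_top m) (min_le_left (m : ℕ∞) (upcrossings ω a b t)))
  rw [← hn, ENat.toNat_natCast]
  have hnm : n ≤ m := by exact_mod_cast hn.trans_le (min_le_left _ _)
  have hup : IsUpcrossingSeq ω a b t n :=
    isUpcrossingSeq_of_le_upcrossings (hn.trans_le (min_le_right _ _))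
  have key := mul_min_sub_le_sum_gain hT.le hright hnonneg ha.le hab.le ht hup m
  have hif : (if m ≤ n ∨ upTimes ω a b T (2 * m) < t then 0 else a) ≤ a := by
    split_ifs <;> linarith
  rw [min_eq_right hnm] at key
  exact le_trans (by linarith) key
end

section
/- Define f(x) := x^{1/3} for x ≥ 0, and for k ≥ 1 set t_k := 1/k, s_k := (t_{k+1} + t_k)/2, c_k := 2 f(s_k)/(t_k − t_{k+1}). Define ω̂ : [0, 1] → ℝ by ω̂(t) := Σ_{k=1}^∞ [ c_k (t − t_{k+1}) · 1_{(t_{k+1}, s_k]}(t) + (f(s_k) − c_k (t − s_k)) · 1_{(s_k, t_k]}(t) ]. For a function ν : [0, 1] → ℝ define its cubic variation v₃(ν) := sup over all finite partitions 0 = u₀ < u₁ < ⋯ < u_m = 1 of Σ_{j=1}^m |ν(u_j) − ν(u_{j−1})|³. Then for every n ≥ 1, the stopped path ω̂_n defined by ω̂_n(t) := ω̂(t ∧ t_n) satisfies v₃(ω̂_n) = ∞. -/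
open Filter Topology

/-- `t_k := 1/k`. -/
noncomputable def tt (k : ℕ) : ℝ := 1 / k

/-- `s_k := (t_{k+1} + t_k)/2`. -/
noncomputable def ss (k : ℕ) : ℝ := (tt (k + 1) + tt k) / 2

/-- `f(x) := x^{1/3}`. -/
noncomputable def ff (x : ℝ) : ℝ := x ^ (1 / 3 : ℝ)

/-- `c_k := 2 f(s_k) / (t_k − t_{k+1})`. -/
noncomputable def cc (k : ℕ) : ℝ := 2 * ff (ss k) / (tt k - tt (k + 1))

/-- The path `ω̂(t) = Σ_{k=1}^∞ [c_k (t − t_{k+1}) 1_{(t_{k+1}, s_k]}(t)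
+ (f(s_k) − c_k (t − s_k)) 1_{(s_k, t_k]}(t)]`. -/
noncomputable def omegaHat (t : ℝ) : ℝ :=
  ∑' k : ℕ,
    ((Set.Ioc (tt (k + 2)) (ss (k + 1))).indicator
        (fun s => cc (k + 1) * (s - tt (k + 2))) t
      + (Set.Ioc (ss (k + 1)) (tt (k + 1))).indicator
          (fun s => ff (ss (k + 1)) - cc (k + 1) * (s - ss (k + 1))) t)

/-- The cubic variation `v₃(ν)` over finite partitions `0 = u₀ < u₁ < ⋯ < u_m = 1`,
valued in `[0, ∞]`. -/
noncomputable def cubicVar (ν : ℝ → ℝ) : ENNReal :=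
  sSup {v : ENNReal | ∃ (m : ℕ) (u : ℕ → ℝ), 0 < m ∧ u 0 = 0 ∧ u m = 1 ∧
    StrictMonoOn u (Set.Iic m) ∧
    v = ∑ j ∈ Finset.range m, ENNReal.ofReal (|ν (u (j + 1)) - ν (u j)| ^ 3)}

theorem tt_antitone {j k : ℕ} (h : j ≤ k) : tt (k + 1) ≤ tt (j + 1) := by
  unfold tt
  exact one_div_le_one_div_of_le (by positivity) (by exact_mod_cast Nat.succ_le_succ h)

theorem tt_succ_lt (k : ℕ) : tt (k + 2) < tt (k + 1) := by
  unfold tt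
  exact one_div_lt_one_div_of_lt (by positivity) (by exact_mod_cast Nat.lt_succ_self (k + 1))

theorem tt_lt_ss (k : ℕ) : tt (k + 2) < ss (k + 1) := by
  have h := tt_succ_lt k
  change _ < (tt (k + 2) + tt (k + 1)) / 2
  linarith

theorem ss_lt_tt (k : ℕ) : ss (k + 1) < tt (k + 1) := by
  have h := tt_succ_lt k
  change (tt (k + 2) + tt (k + 1)) / 2 < _
  linarith

theorem tt_pos (k : ℕ) : 0 < tt (k + 1) := by
  unfold tt
  positivity

/-- On `(t_{k+2}, t_{k+1}]` only one summand of `omegaHat` survives. -/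
theorem omegaHat_eq_of_mem {k : ℕ} {t : ℝ} (ht : t ∈ Set.Ioc (tt (k + 2)) (tt (k + 1))) :
    omegaHat t =
      (Set.Ioc (tt (k + 2)) (ss (k + 1))).indicator
        (fun s => cc (k + 1) * (s - tt (k + 2))) t
      + (Set.Ioc (ss (k + 1)) (tt (k + 1))).indicator
          (fun s => ff (ss (k + 1)) - cc (k + 1) * (s - ss (k + 1))) t := by
  unfold omegaHat
  refine tsum_eq_single k fun j hj => ?_
  have h₁ := tt_lt_ss j
  have h₂ := ss_lt_tt j
  obtain ⟨hl, hr⟩ := ht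
  rcases lt_or_gt_of_ne hj with h | h
  · have h₃ : tt (k + 1) ≤ tt (j + 2) := tt_antitone (Nat.succ_le_of_lt h)
    rw [Set.indicator_of_notMem, Set.indicator_of_notMem, add_zero]
    · exact fun hm => by linarith [hm.1]
    · exact fun hm => by linarith [hm.1]
  · have h₃ : tt (j + 1) ≤ tt (k + 2) := tt_antitone (Nat.succ_le_of_lt h)
    rw [Set.indicator_of_notMem, Set.indicator_of_notMem, add_zero]
    · exact fun hm => by linarith [hm.2]
    · exact fun hm => by linarith [hm.2]

theorem omegaHat_tt (k : ℕ) : omegaHat (tt (k + 1)) = 0 := by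
  have h := tt_succ_lt k
  have hs := ss_lt_tt k
  rw [omegaHat_eq_of_mem ⟨h, le_rfl⟩, Set.indicator_of_notMem (fun hm => by linarith [hm.2]),
    Set.indicator_of_mem (Set.right_mem_Ioc.2 hs)]
  have hd : tt (k + 1) - tt (k + 1 + 1) ≠ 0 := sub_ne_zero.2 h.ne'
  have he : tt (k + 1) - ss (k + 1) = (tt (k + 1) - tt (k + 1 + 1)) / 2 := by
    unfold ss
    ring
  rw [he]
  unfold cc
  field_simp
  ring

theorem omegaHat_ss (k : ℕ) : omegaHat (ss (k + 1)) = ff (ss (k + 1)) := by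
  have h := tt_succ_lt k
  have hs := tt_lt_ss k
  rw [omegaHat_eq_of_mem ⟨hs, (ss_lt_tt k).le⟩, Set.indicator_of_mem (Set.right_mem_Ioc.2 hs),
    Set.indicator_of_notMem (fun hm => by linarith [hm.1])]
  have hd : tt (k + 1) - tt (k + 1 + 1) ≠ 0 := sub_ne_zero.2 h.ne'
  have he : ss (k + 1) - tt (k + 2) = (tt (k + 1) - tt (k + 1 + 1)) / 2 := by
    unfold ss
    ring
  rw [he]
  unfold cc
  field_simp
  ring

theorem ff_pow_three {x : ℝ} (hx : 0 ≤ x) : ff x ^ 3 = x := by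
  unfold ff
  rw [← Real.rpow_natCast, ← Real.rpow_mul hx]
  norm_num

/-- The points `t_1 > s_1 > t_2 > s_2 > ⋯` listed in decreasing order. -/
noncomputable def zigzag (i : ℕ) : ℝ :=
  if Even i then tt (i / 2 + 1) else ss (i / 2 + 1)

theorem zigzag_even (k : ℕ) : zigzag (2 * k) = tt (k + 1) := by
  simp [zigzag]

theorem zigzag_odd (k : ℕ) : zigzag (2 * k + 1) = ss (k + 1) := by
  have h : (2 * k + 1) / 2 = k := by omega
  simp [zigzag, h]

theorem zigzag_strictAnti : StrictAnti zigzag := by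
  refine strictAnti_nat_of_succ_lt fun i => ?_
  obtain ⟨k, rfl | rfl⟩ := Nat.even_or_odd' i
  · rw [zigzag_even, zigzag_odd]
    exact ss_lt_tt k
  · rw [zigzag_odd, show 2 * k + 1 + 1 = 2 * (k + 1) by ring, zigzag_even]
    exact tt_lt_ss k

theorem zigzag_pos (i : ℕ) : 0 < zigzag i := by
  obtain ⟨k, rfl | rfl⟩ := Nat.even_or_odd' i
  · rw [zigzag_even]
    exact tt_pos k
  · rw [zigzag_odd]
    exact (tt_pos (k + 1)).trans (tt_lt_ss k)

/-- Cubic increments along a decreasing sequence in `(0, 1]` starting at `1` are bounded by the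
cubic variation. -/
theorem tsum_le_cubicVar (ν : ℝ → ℝ) {g : ℕ → ℝ} (hg : StrictAnti g) (hpos : ∀ i, 0 < g i)
    (hone : g 0 = 1) :
    ∑' i, ENNReal.ofReal (|ν (g i) - ν (g (i + 1))| ^ 3) ≤ cubicVar ν := by
  refine ENNReal.tsum_le_of_sum_range_le fun M => ?_
  let u : ℕ → ℝ := fun j => if j = 0 then 0 else g (M + 1 - j)
  have hu : StrictMonoOn u (Set.Iic (M + 1)) := by
    intro i hi j hj hij
    have hj' : j ≤ M + 1 := hj
    have hj0 : j ≠ 0 := by omega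
    by_cases hi0 : i = 0
    · simpa [u, hi0, hj0] using hpos _
    · simpa [u, hi0, hj0] using hg (by omega : M + 1 - j < M + 1 - i)
  refine le_trans ?_ (le_sSup ⟨M + 1, u, M.succ_pos, by simp [u], by simp [u, hone], hu, rfl⟩)
  rw [Finset.sum_range_succ', ← Finset.sum_range_reflect]
  refine le_add_right (Finset.sum_le_sum fun j hj => ?_)
  have hj' : j < M := Finset.mem_range.1 hj
  have h₁ : M + 1 - (j + 1 + 1) = M - 1 - j := by omega
  have h₂ : M + 1 - (j + 1) = M - 1 - j + 1 := by omega
  simp [u, h₁, h₂]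

theorem tsum_ofReal_one_div_add (n : ℕ) :
    ∑' k : ℕ, ENNReal.ofReal (1 / ((k + n : ℕ) : ℝ)) = ⊤ := by
  by_contra h
  have hs := ENNReal.summable_toReal h
  have he : ∀ k : ℕ, (ENNReal.ofReal (1 / ((k + n : ℕ) : ℝ))).toReal = 1 / ((k + n : ℕ) : ℝ) :=
    fun k => ENNReal.toReal_ofReal (by positivity)
  simp only [he] at hs
  exact Real.not_summable_one_div_natCast ((summable_nat_add_iff n).1 hs)

theorem statement17 (n : ℕ) (hn : 1 ≤ n) :
    cubicVar (fun t => omegaHat (min t (tt n))) = ⊤ := by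
  obtain ⟨n, rfl⟩ : ∃ p, n = p + 1 := ⟨n - 1, by omega⟩
  set ν : ℝ → ℝ := fun t => omegaHat (min t (tt (n + 1))) with hν
  have hone : zigzag 0 = 1 := by simp [zigzag, tt]
  refine top_unique (le_trans ?_ (tsum_le_cubicVar ν zigzag_strictAnti zigzag_pos hone))
  have hinj : Function.Injective fun k : ℕ => 2 * (k + n) := fun a b h => by
    simp only at h
    omega
  refine le_trans ?_ (ENNReal.tsum_comp_le_tsum_of_injective hinj _)
  rw [← tsum_ofReal_one_div_add (n + 2)]
  refine ENNReal.tsum_le_tsum fun k => ENNReal.ofReal_le_ofReal ?_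
  have ht : tt (k + n + 1) ≤ tt (n + 1) := tt_antitone (Nat.le_add_left n k)
  have hs := ss_lt_tt (k + n)
  have hl := tt_lt_ss (k + n)
  have h0 : 0 < ss (k + n + 1) := (tt_pos (k + n + 1)).trans hl
  have hff : 0 ≤ ff (ss (k + n + 1)) := Real.rpow_nonneg h0.le _
  simp only [zigzag_even, zigzag_odd, hν]
  rw [min_eq_left ht, min_eq_left (hs.le.trans ht), omegaHat_tt, omegaHat_ss, zero_sub, abs_neg,
    abs_of_nonneg hff, ff_pow_three h0.le]
  exact hl.le
end
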